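/- arXiv:1912.06136 — 3 statements merged into one kernel-verified Lean document; each statement's English description precedes it below -/
import Mathlib

section
/- Let p(x,y,z) and q(x,y,z) be linearly independent homogeneous polynomials of degree 2 over ℂ. Then the polynomial r = α·p + β·q is factorizable (i.e., a product of two homogeneous linear polynomials) for every pair (α,β) ∈ ℂ² with (α,β) ≠ (0,0) if and only if at least one of the following conditions holds: (a) p and q have a common linear factor, i.e., p = ℓ·ℓ₁ and q = ℓ·ℓ₂ for some nonzero homogeneous linear polynomials ℓ, ℓ₁, ℓ₂ in x,y,z; (b) there exist homogeneous linear polynomials s = a₁x + b₁y + c₁z and t = a₂x + b₂y + c₂z and bivariate homogeneous polynomials f, g of degree 2 such that p(x,y,z) = f(s,t) and q(x,y,z) = g(s,t). -/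
open MvPolynomial

/-- A trivariate homogeneous polynomial of degree 2 is *factorizable* if it can be
written as a product of two homogeneous polynomials of degree 1 (linear forms). -/
def Factorizable3 (r : MvPolynomial (Fin 3) ℂ) : Prop :=
  ∃ ℓ₁ ℓ₂ : MvPolynomial (Fin 3) ℂ,
    ℓ₁.IsHomogeneous 1 ∧ ℓ₂.IsHomogeneous 1 ∧ r = ℓ₁ * ℓ₂

/-- The linear form `∑ i, v i * X i` with coefficient vector `v`. -/
noncomputable def linearForm {n : ℕ} : (Fin n → ℂ) →ₗ[ℂ] MvPolynomial (Fin n) ℂ :=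
  Fintype.linearCombination ℂ X

theorem linearForm_apply {n : ℕ} (v : Fin n → ℂ) : linearForm v = ∑ i, v i • X i :=
  Fintype.linearCombination_apply ..

theorem eval_linearForm {n : ℕ} (v x : Fin n → ℂ) :
    eval x (linearForm v) = ∑ i, v i * x i := by
  simp [linearForm_apply, smul_eval]

theorem isHomogeneous_linearForm {n : ℕ} (v : Fin n → ℂ) : (linearForm v).IsHomogeneous 1 := by
  rw [linearForm_apply]
  refine IsHomogeneous.sum _ _ _ fun i _ => ?_
  rw [smul_eq_C_mul]
  exact isHomogeneous_C_mul_X _ _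

theorem MvPolynomial.IsHomogeneous.exists_eq_linearForm {n : ℕ} {φ : MvPolynomial (Fin n) ℂ}
    (h : φ.IsHomogeneous 1) : ∃ v, φ = linearForm v := by
  rw [← mem_homogeneousSubmodule, homogeneousSubmodule_one_eq_span_X,
    ← Fintype.range_linearCombination] at h
  obtain ⟨v, hv⟩ := h
  exact ⟨v, hv.symm⟩

theorem MvPolynomial.IsHomogeneous.exists_eq_binary_quadratic {f : MvPolynomial (Fin 2) ℂ}
    (hf : f.IsHomogeneous 2) :
    ∃ u v w : ℂ, f = C u * X 0 ^ 2 + C v * (X 0 * X 1) + C w * X 1 ^ 2 := by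
  rw [← mem_homogeneousSubmodule, ← homogeneousSubmodule_one_pow, pow_two] at hf
  induction hf using Submodule.mul_induction_on' with
  | mem_mul_mem m hm n hn =>
    obtain ⟨a, rfl⟩ := IsHomogeneous.exists_eq_linearForm hm
    obtain ⟨b, rfl⟩ := IsHomogeneous.exists_eq_linearForm hn
    refine ⟨a 0 * b 0, a 0 * b 1 + a 1 * b 0, a 1 * b 1, ?_⟩
    simp only [linearForm_apply, Fin.sum_univ_two, smul_eq_C_mul, MvPolynomial.C_mul, C_add]
    ring
  | add x _ y _ hx hy =>
    obtain ⟨u, v, w, rfl⟩ := hx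
    obtain ⟨u', v', w', rfl⟩ := hy
    refine ⟨u + u', v + v', w + w', ?_⟩
    simp only [C_add]
    ring

theorem exists_quadratic_root {u : ℂ} (hu : u ≠ 0) (v w : ℂ) :
    ∃ r, u * (r * r) + v * r + w = 0 :=
  exists_quadratic_eq_zero hu (IsAlgClosed.exists_eq_mul_self _)

/-- A binary quadratic form evaluated at two linear forms is factorizable. -/
theorem factorizable3_aeval {s t : MvPolynomial (Fin 3) ℂ} {f : MvPolynomial (Fin 2) ℂ}
    (hs : s.IsHomogeneous 1) (ht : t.IsHomogeneous 1) (hf : f.IsHomogeneous 2) :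
    Factorizable3 (aeval ![s, t] f) := by
  obtain ⟨u, v, w, rfl⟩ := hf.exists_eq_binary_quadratic
  by_cases hu : u = 0
  · refine ⟨t, C v * s + C w * t, ht, (hs.C_mul v).add (ht.C_mul w), ?_⟩
    simp [hu, algebraMap_eq]
    ring
  · obtain ⟨r, hr⟩ := exists_quadratic_root hu v w
    refine ⟨s - C r * t, C u * s + C (v + u * r) * t, hs.sub (ht.C_mul r),
      (hs.C_mul u).add (ht.C_mul _), ?_⟩
    have hroot : (C u * (C r * C r) + C v * C r + C w : MvPolynomial (Fin 3) ℂ) = 0 := by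
      simp only [← C_mul, ← C_add, hr, C_0]
    simp only [map_add, map_mul, map_pow, aeval_X, aeval_C, algebraMap_eq, Matrix.cons_val_zero,
      Matrix.cons_val_one]
    linear_combination t ^ 2 * hroot

/-- If `a b + k c d` is a product of two linear forms, its discriminant vanishes. -/
theorem det_relation_of_factorizable3 {a b c d : Fin 3 → ℂ} {k : ℂ}
    (h : Factorizable3
      (linearForm a * linearForm b + k • (linearForm c * linearForm d))) :
    k * ((Matrix.of ![a, b, c]).det * (Matrix.of ![a, b, d]).det) +
      k ^ 2 * ((Matrix.of ![c, d, a]).det * (Matrix.of ![c, d, b]).det) = 0 := by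
  obtain ⟨_, _, h₁, h₂, h⟩ := h
  obtain ⟨e, rfl⟩ := h₁.exists_eq_linearForm
  obtain ⟨f, rfl⟩ := h₂.exists_eq_linearForm
  have hx (x : Fin 3 → ℂ) := congrArg (eval x) h
  simp only [map_add, map_mul, smul_eval, eval_linearForm, Fin.sum_univ_three] at hx
  have h0 := hx ![1, 0, 0]
  have h1 := hx ![0, 1, 0]
  have h2 := hx ![0, 0, 1]
  have h01 := hx ![1, 1, 0]
  have h02 := hx ![1, 0, 1]
  have h12 := hx ![0, 1, 1]
  simp at h0 h1 h2 h01 h02 h12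
  replace h01 : (a 0 * b 1 + a 1 * b 0) + k * (c 0 * d 1 + c 1 * d 0) =
      e 0 * f 1 + e 1 * f 0 := by linear_combination h01 - h0 - h1
  replace h02 : (a 0 * b 2 + a 2 * b 0) + k * (c 0 * d 2 + c 2 * d 0) =
      e 0 * f 2 + e 2 * f 0 := by linear_combination h02 - h0 - h2
  replace h12 : (a 1 * b 2 + a 2 * b 1) + k * (c 1 * d 2 + c 2 * d 1) =
      e 1 * f 2 + e 2 * f 1 := by linear_combination h12 - h1 - h2
  have key : 4 * (e 0 * f 0) * (e 1 * f 1) * (e 2 * f 2) +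
      (e 1 * f 2 + e 2 * f 1) * (e 0 * f 2 + e 2 * f 0) * (e 0 * f 1 + e 1 * f 0) -
      (e 0 * f 0) * (e 1 * f 2 + e 2 * f 1) ^ 2 - (e 1 * f 1) * (e 0 * f 2 + e 2 * f 0) ^ 2 -
      (e 2 * f 2) * (e 0 * f 1 + e 1 * f 0) ^ 2 = 0 := by ring
  rw [← h0, ← h1, ← h2, ← h01, ← h02, ← h12] at key
  simp only [Matrix.det_fin_three, Matrix.of_apply, Matrix.cons_val_zero, Matrix.cons_val_one, Matrix.cons_val]
  linear_combination -key

theorem exists_smul_or_mem_span_of_det_eq_zero {u v w : Fin 3 → ℂ} (hw : w ≠ 0)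
    (h : (Matrix.of ![u, v, w]).det = 0) :
    (∃ k : ℂ, u = k • w) ∨ ∃ m n : ℂ, v = m • u + n • w := by
  obtain ⟨x, hx, hxM⟩ := Matrix.exists_vecMul_eq_zero_iff.mpr h
  have hsum : x 0 • u + x 1 • v + x 2 • w = 0 := by
    ext i
    simpa [Matrix.vecMul, dotProduct, Fin.sum_univ_three] using congrFun hxM i
  by_cases h1 : x 1 = 0
  · left
    simp only [h1, zero_smul, add_zero] at hsum
    by_cases h0 : x 0 = 0
    · simp only [h0, zero_smul, zero_add, smul_eq_zero, hw, or_false] at hsum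
      exact absurd (_root_.funext fun i => by fin_cases i <;> assumption) hx
    · refine ⟨-(x 2 / x 0), ?_⟩
      ext i
      have := congrFun hsum i
      simp only [Pi.add_apply, Pi.smul_apply, smul_eq_mul, Pi.zero_apply] at this ⊢
      field_simp
      linear_combination this
  · right
    refine ⟨-(x 0 / x 1), -(x 2 / x 1), ?_⟩
    ext i
    have := congrFun hsum i
    simp only [Pi.add_apply, Pi.smul_apply, smul_eq_mul, Pi.zero_apply] at this ⊢
    field_simp
    linear_combination this

/-- `p` and `q` are both divisible by a nonzero linear form, with nonzero linear cofactors. -/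
def HasCommonLinearFactor (p q : MvPolynomial (Fin 3) ℂ) : Prop :=
  ∃ ℓ ℓ₁ ℓ₂ : MvPolynomial (Fin 3) ℂ,
    ℓ.IsHomogeneous 1 ∧ ℓ₁.IsHomogeneous 1 ∧ ℓ₂.IsHomogeneous 1 ∧
    ℓ ≠ 0 ∧ ℓ₁ ≠ 0 ∧ ℓ₂ ≠ 0 ∧ p = ℓ * ℓ₁ ∧ q = ℓ * ℓ₂

/-- `p` and `q` are binary quadratic forms in the same two linear forms. -/
def AreBinaryQuadratics (p q : MvPolynomial (Fin 3) ℂ) : Prop :=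
  ∃ s t : MvPolynomial (Fin 3) ℂ, ∃ f g : MvPolynomial (Fin 2) ℂ,
    s.IsHomogeneous 1 ∧ t.IsHomogeneous 1 ∧ f.IsHomogeneous 2 ∧ g.IsHomogeneous 2 ∧
    p = aeval ![s, t] f ∧ q = aeval ![s, t] g

theorem hasCommonLinearFactor_of_eq_mul {p q : MvPolynomial (Fin 3) ℂ} (hp : p ≠ 0) (hq : q ≠ 0)
    (u v w : Fin 3 → ℂ) (hpu : p = linearForm u * linearForm v)
    (hqu : q = linearForm u * linearForm w) : HasCommonLinearFactor p q :=
  ⟨_, _, _, isHomogeneous_linearForm u, isHomogeneous_linearForm v, isHomogeneous_linearForm w,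
    left_ne_zero_of_mul (hpu ▸ hp), right_ne_zero_of_mul (hpu ▸ hp),
    right_ne_zero_of_mul (hqu ▸ hq), hpu, hqu⟩

theorem commonFactor_or_binary_of_det_eq_zero {p q : MvPolynomial (Fin 3) ℂ}
    (hp : p ≠ 0) (hq : q ≠ 0) {a b c d : Fin 3 → ℂ}
    (hpab : p = linearForm a * linearForm b) (hqcd : q = linearForm c * linearForm d)
    (h₁ : (Matrix.of ![a, b, c]).det = 0) (h₂ : (Matrix.of ![c, d, a]).det = 0) :
    HasCommonLinearFactor p q ∨ AreBinaryQuadratics p q := by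
  have ha : a ≠ 0 := by
    rintro rfl
    simp [hpab] at hp
  have hc : c ≠ 0 := by
    rintro rfl
    simp [hqcd] at hq
  obtain ⟨k, rfl⟩ | ⟨m, n, rfl⟩ := exists_smul_or_mem_span_of_det_eq_zero hc h₁
  · exact .inl (hasCommonLinearFactor_of_eq_mul hp hq c (k • b) d (by simp [hpab]) hqcd)
  obtain ⟨k, rfl⟩ | ⟨m', n', rfl⟩ := exists_smul_or_mem_span_of_det_eq_zero ha h₂
  · exact .inl (hasCommonLinearFactor_of_eq_mul hp hq a _ (k • d) hpab (by simp [hqcd]))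
  refine .inr ⟨linearForm a, linearForm c, linearForm ![1, 0] * linearForm ![m, n],
    linearForm ![0, 1] * linearForm ![n', m'], isHomogeneous_linearForm a,
    isHomogeneous_linearForm c, (isHomogeneous_linearForm _).mul (isHomogeneous_linearForm _),
    (isHomogeneous_linearForm _).mul (isHomogeneous_linearForm _), ?_, ?_⟩
  · rw [hpab, map_add, map_smul, map_smul]
    simp [linearForm_apply (n := 2)]
  · rw [hqcd, map_add, map_smul, map_smul]
    simp [linearForm_apply (n := 2), add_comm]

/-- **Theorem 1 (homogeneous case).** For linearly independent homogeneous quadratics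
`p, q` in `ℂ[x,y,z]`, every nontrivial linear combination `α•p + β•q` is factorizable
iff (a) `p` and `q` have a common linear factor, or (b) `p = f(s,t)`, `q = g(s,t)` for
linear forms `s, t` and bivariate homogeneous quadratics `f, g`. -/
theorem all_combinations_factorizable_iff
    (p q : MvPolynomial (Fin 3) ℂ)
    (hp : p.IsHomogeneous 2) (hq : q.IsHomogeneous 2)
    (hind : LinearIndependent ℂ ![p, q]) :
    (∀ α β : ℂ, (α, β) ≠ (0, 0) → Factorizable3 (α • p + β • q)) ↔
      ((∃ ℓ ℓ₁ ℓ₂ : MvPolynomial (Fin 3) ℂ,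
          ℓ.IsHomogeneous 1 ∧ ℓ₁.IsHomogeneous 1 ∧ ℓ₂.IsHomogeneous 1 ∧
          ℓ ≠ 0 ∧ ℓ₁ ≠ 0 ∧ ℓ₂ ≠ 0 ∧
          p = ℓ * ℓ₁ ∧ q = ℓ * ℓ₂) ∨
       (∃ s t : MvPolynomial (Fin 3) ℂ, ∃ f g : MvPolynomial (Fin 2) ℂ,
          s.IsHomogeneous 1 ∧ t.IsHomogeneous 1 ∧
          f.IsHomogeneous 2 ∧ g.IsHomogeneous 2 ∧
          p = aeval ![s, t] f ∧ q = aeval ![s, t] g)) := by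
  constructor
  · intro h
    have hp0 : p ≠ 0 := by simpa using hind.ne_zero 0
    have hq0 : q ≠ 0 := by simpa using hind.ne_zero 1
    have hpf : Factorizable3 p := by simpa using h 1 0 (by simp)
    have hqf : Factorizable3 q := by simpa using h 0 1 (by simp)
    obtain ⟨_, _, ha, hb, hpab⟩ := hpf
    obtain ⟨_, _, hc, hd, hqcd⟩ := hqf
    obtain ⟨a, rfl⟩ := ha.exists_eq_linearForm
    obtain ⟨b, rfl⟩ := hb.exists_eq_linearForm
    obtain ⟨c, rfl⟩ := hc.exists_eq_linearForm
    obtain ⟨d, rfl⟩ := hd.exists_eq_linearForm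
    have hpos := det_relation_of_factorizable3 (a := a) (b := b) (c := c) (d := d) (k := 1)
      (by simpa [hpab, hqcd] using h 1 1 (by simp))
    have hneg := det_relation_of_factorizable3 (a := a) (b := b) (c := c) (d := d) (k := -1)
      (by simpa [hpab, hqcd] using h 1 (-1) (by simp))
    have h₁ : (Matrix.of ![a, b, c]).det * (Matrix.of ![a, b, d]).det = 0 := by
      linear_combination (hpos - hneg) / 2
    have h₂ : (Matrix.of ![c, d, a]).det * (Matrix.of ![c, d, b]).det = 0 := by
      linear_combination (hpos + hneg) / 2
    have hpba := hpab.trans (mul_comm _ _)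
    have hqdc := hqcd.trans (mul_comm _ _)
    have swap {u v w : Fin 3 → ℂ} (h : (Matrix.of ![u, v, w]).det = 0) :
        (Matrix.of ![v, u, w]).det = 0 := by
      simp only [Matrix.det_fin_three, Matrix.of_apply, Matrix.cons_val_zero, Matrix.cons_val_one,
        Matrix.cons_val] at h ⊢
      linear_combination -h
    rcases mul_eq_zero.mp h₁ with h₁ | h₁ <;> rcases mul_eq_zero.mp h₂ with h₂ | h₂
    · exact commonFactor_or_binary_of_det_eq_zero hp0 hq0 hpab hqcd h₁ h₂
    · exact commonFactor_or_binary_of_det_eq_zero hp0 hq0 hpba hqcd (swap h₁) h₂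
    · exact commonFactor_or_binary_of_det_eq_zero hp0 hq0 hpab hqdc h₁ (swap h₂)
    · exact commonFactor_or_binary_of_det_eq_zero hp0 hq0 hpba hqdc (swap h₁) (swap h₂)
  · rintro (⟨ℓ, ℓ₁, ℓ₂, hℓ, hℓ₁, hℓ₂, -, -, -, rfl, rfl⟩ |
      ⟨s, t, f, g, hs, ht, hf, hg, rfl, rfl⟩) α β -
    · refine ⟨ℓ, C α * ℓ₁ + C β * ℓ₂, hℓ, (hℓ₁.C_mul α).add (hℓ₂.C_mul β), ?_⟩
      simp only [smul_eq_C_mul]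
      ring
    · rw [← map_smul, ← map_smul, ← map_add, smul_eq_C_mul, smul_eq_C_mul]
      exact factorizable3_aeval hs ht ((hf.C_mul α).add (hg.C_mul β))
end

section
/- Let p = ℓ₁·ℓ₂ and q = ℓ₃·ℓ₄ be linearly independent homogeneous polynomials of degree 2 over ℂ, where ℓ₁, ℓ₂, ℓ₃, ℓ₄ are homogeneous linear polynomials in x, y, z. Suppose there exist two noncollinear vectors (α₁, β₁), (α₂, β₂) ∈ ℂ² with α₁β₁α₂β₂ ≠ 0 such that both polynomials α₁·p + β₁·q and α₂·p + β₂·q are factorizable. Then α·p + β·q is factorizable for every pair (α, β) ∈ ℂ². Moreover, at least one of the following holds: (i) p and q have a common linear factor; (ii) the four linear forms ℓ₁, ℓ₂, ℓ₃, ℓ₄ span a linear space of dimension 2 (i.e., the four lines ℓᵢ(x,y,z) = 0 are concurrent in the projective plane). -/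
open MvPolynomial

/-- A binary quadratic form over `ℂ` splits into linear factors (coefficient form). -/
lemma exists_binary_quadratic_factorization (a b c : ℂ) :
    ∃ m n m' n' : ℂ, a = m * m' ∧ b = m * n' + n * m' ∧ c = n * n' := by
  by_cases ha : a = 0
  · exact ⟨0, 1, b, c, by simp [ha], by simp, by simp⟩
  · obtain ⟨s, hs⟩ := IsAlgClosed.exists_pow_nat_eq (b ^ 2 - 4 * a * c) two_pos
    refine ⟨a, (b + s) / 2, 1, (b - s) / (2 * a), by ring, ?_, ?_⟩
    · field_simp
      ring
    · field_simp
      linear_combination hs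

/-- Any member of a pencil generated by products of linear combinations of `u` and `v` is
factorizable. -/
lemma factorizable3_of_mem_span_pair {u v a b c d : MvPolynomial (Fin 3) ℂ}
    (hu : u.IsHomogeneous 1) (hv : v.IsHomogeneous 1)
    (ha : a ∈ Submodule.span ℂ {u, v}) (hb : b ∈ Submodule.span ℂ {u, v})
    (hc : c ∈ Submodule.span ℂ {u, v}) (hd : d ∈ Submodule.span ℂ {u, v}) (α β : ℂ) :
    Factorizable3 (α • (a * b) + β • (c * d)) := by
  rw [Submodule.mem_span_pair] at ha hb hc hd
  obtain ⟨a₁, a₂, rfl⟩ := ha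
  obtain ⟨b₁, b₂, rfl⟩ := hb
  obtain ⟨c₁, c₂, rfl⟩ := hc
  obtain ⟨d₁, d₂, rfl⟩ := hd
  obtain ⟨m, n, m', n', h₁, h₂, h₃⟩ := exists_binary_quadratic_factorization
    (α * (a₁ * b₁) + β * (c₁ * d₁))
    (α * (a₁ * b₂ + a₂ * b₁) + β * (c₁ * d₂ + c₂ * d₁)) (α * (a₂ * b₂) + β * (c₂ * d₂))
  have hom (s t : ℂ) : (s • u + t • v).IsHomogeneous 1 := by
    simpa only [smul_eq_C_mul] using (hu.C_mul s).add (hv.C_mul t)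
  refine ⟨m • u + n • v, m' • u + n' • v, hom m n, hom m' n', ?_⟩
  replace h₁ := congrArg (C (σ := Fin 3)) h₁
  replace h₂ := congrArg (C (σ := Fin 3)) h₂
  replace h₃ := congrArg (C (σ := Fin 3)) h₃
  simp only [map_add, map_mul] at h₁ h₂ h₃
  simp only [smul_eq_C_mul]
  linear_combination u ^ 2 * h₁ + u * v * h₂ + v ^ 2 * h₃

/-- If `b` and `d` each form a linearly dependent triple with `a, c`, then the pencil spanned by
`a * b` and `c * d` is totally factorizable, and its generators share a factor or are
concurrent. -/
lemma factorizable3_pencil_of_dependent {a b c d : MvPolynomial (Fin 3) ℂ}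
    (ha : a.IsHomogeneous 1) (hb : b.IsHomogeneous 1)
    (hc : c.IsHomogeneous 1) (hd : d.IsHomogeneous 1)
    (hab : a * b ≠ 0) (hcd : c * d ≠ 0)
    (hbac : ¬ LinearIndependent ℂ ![b, a, c]) (hdac : ¬ LinearIndependent ℂ ![d, a, c]) :
    (∀ α β : ℂ, Factorizable3 (α • (a * b) + β • (c * d))) ∧
    ((∃ ℓ' ℓ₁' ℓ₂' : MvPolynomial (Fin 3) ℂ,
        ℓ'.IsHomogeneous 1 ∧ ℓ₁'.IsHomogeneous 1 ∧ ℓ₂'.IsHomogeneous 1 ∧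
        ℓ' ≠ 0 ∧ ℓ₁' ≠ 0 ∧ ℓ₂' ≠ 0 ∧
        a * b = ℓ' * ℓ₁' ∧ c * d = ℓ' * ℓ₂') ∨
     Module.finrank ℂ (Submodule.span ℂ {a, b, c, d}) = 2) := by
  by_cases hac : LinearIndependent ℂ ![a, c]
  · have mem {x : MvPolynomial (Fin 3) ℂ} (hx : ¬ LinearIndependent ℂ ![x, a, c]) :
        x ∈ Submodule.span ℂ {a, c} := by
      have h := mt linearIndependent_finCons.2 hx
      simpa [hac, Set.pair_comm c a] using h
    have hb' := mem hbac
    have hd' := mem hdac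
    have ha' : a ∈ Submodule.span ℂ {a, c} := Submodule.subset_span (by simp)
    have hc' : c ∈ Submodule.span ℂ {a, c} := Submodule.subset_span (by simp)
    refine ⟨factorizable3_of_mem_span_pair ha hc ha' hb' hc' hd', .inr ?_⟩
    have hspan : Submodule.span ℂ {a, b, c, d} = Submodule.span ℂ (Set.range ![a, c]) := by
      rw [Matrix.range_cons_cons_empty]
      refine le_antisymm (Submodule.span_le.2 ?_) (Submodule.span_mono ?_)
      · rintro x (rfl | rfl | rfl | rfl) <;> assumption
      · rintro x (rfl | rfl) <;> simp
    rw [hspan, finrank_span_eq_card hac, Fintype.card_fin]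
  · have ha₀ : a ≠ 0 := left_ne_zero_of_mul hab
    rw [LinearIndependent.pair_iff' ha₀] at hac
    push Not at hac
    obtain ⟨k, rfl⟩ := hac
    have hkd : (k • d).IsHomogeneous 1 := by simpa only [smul_eq_C_mul] using hd.C_mul k
    have hcd' : k • a * d = a * (k • d) := by rw [smul_mul_assoc, mul_smul_comm]
    refine ⟨fun α β => ⟨a, α • b + β • k • d, ha, ?_, ?_⟩, .inl ⟨a, b, k • d, ha, hb, hkd, ha₀,
      right_ne_zero_of_mul hab, right_ne_zero_of_mul (hcd' ▸ hcd), rfl, hcd'⟩⟩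
    · simpa only [smul_eq_C_mul] using (hb.C_mul α).add (hkd.C_mul β)
    · rw [hcd', mul_add, mul_smul_comm α, mul_smul_comm β]

/-- A linear form in three variables is determined by a coefficient vector. -/
lemma exists_linearCombination_X_eq {f : MvPolynomial (Fin 3) ℂ} (hf : f.IsHomogeneous 1) :
    ∃ v : Fin 3 → ℂ, Fintype.linearCombination ℂ X v = f := by
  rw [← mem_homogeneousSubmodule, homogeneousSubmodule_one_eq_span_X,
    ← Fintype.range_linearCombination] at hf
  exact hf

/-- The determinantal condition satisfied by a factorizable member of the pencil spanned by `a * b` and `c * d`. -/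
lemma det_relation_of_factorizable3_s2 {a b c d : Fin 3 → ℂ} {α β : ℂ} (hαβ : α * β ≠ 0)
    (h : Factorizable3
      (α • (Fintype.linearCombination ℂ X a * Fintype.linearCombination ℂ X b) +
        β • (Fintype.linearCombination ℂ X c * Fintype.linearCombination ℂ X d))) :
    α * (Matrix.det (.of ![c, a, b]) * Matrix.det (.of ![d, a, b])) +
      β * (Matrix.det (.of ![a, c, d]) * Matrix.det (.of ![b, c, d])) = 0 := by
  obtain ⟨m, n, hm, hn, h⟩ := h
  obtain ⟨m, rfl⟩ := exists_linearCombination_X_eq hm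
  obtain ⟨n, rfl⟩ := exists_linearCombination_X_eq hn
  have key (x y z : ℂ) := congrArg (eval ![x, y, z]) h
  simp only [Fintype.linearCombination_apply, Fin.sum_univ_three, map_add, map_mul, smul_eval,
    eval_X, Matrix.cons_val] at key
  have h0 := key 1 0 0
  have h1 := key 0 1 0
  have h2 := key 0 0 1
  have h01 := key 1 1 0
  have h02 := key 1 0 1
  have h12 := key 0 1 1
  have entry : α • (Matrix.vecMulVec a b + Matrix.vecMulVec b a) +
      β • (Matrix.vecMulVec c d + Matrix.vecMulVec d c) =
      Matrix.vecMulVec m n + Matrix.vecMulVec n m := by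
    ext i j
    simp only [Matrix.add_apply, Matrix.smul_apply, Matrix.vecMulVec_apply, smul_eq_mul]
    fin_cases i <;> fin_cases j <;> simp only [Fin.zero_eta, Fin.mk_one, Fin.reduceFinMk]
    · linear_combination 2 * h0
    · linear_combination h01 - h0 - h1
    · linear_combination h02 - h0 - h2
    · linear_combination h01 - h0 - h1
    · linear_combination 2 * h1
    · linear_combination h12 - h1 - h2
    · linear_combination h02 - h0 - h2
    · linear_combination h12 - h1 - h2
    · linear_combination 2 * h2
  have hdet := congrArg Matrix.det entry
  simp only [Matrix.det_fin_three, Matrix.add_apply, Matrix.smul_apply, Matrix.vecMulVec_apply,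
    smul_eq_mul] at hdet
  refine (mul_eq_zero.1 ?_).resolve_left hαβ
  simp only [Matrix.det_fin_three, Matrix.of_apply, Matrix.cons_val]
  linear_combination -hdet / 2

/-- Linear forms whose coefficient matrix is singular are linearly dependent. -/
lemma not_linearIndependent_of_det_eq_zero {u v w : Fin 3 → ℂ} {f g h : MvPolynomial (Fin 3) ℂ}
    (hu : Fintype.linearCombination ℂ X u = f) (hv : Fintype.linearCombination ℂ X v = g)
    (hw : Fintype.linearCombination ℂ X w = h) (hdet : Matrix.det (.of ![u, v, w]) = 0) :
    ¬ LinearIndependent ℂ ![f, g, h] := by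
  subst hu hv hw
  intro hli
  have hrows : LinearIndependent ℂ ![u, v, w] := by
    refine LinearIndependent.of_comp (Fintype.linearCombination ℂ (X (R := ℂ) (σ := Fin 3))) ?_
    convert hli using 1
    ext i : 1
    fin_cases i <;> rfl
  have hunit := (Matrix.linearIndependent_rows_iff_isUnit (A := .of ![u, v, w])).1 hrows
  rw [Matrix.isUnit_iff_isUnit_det, hdet] at hunit
  exact not_isUnit_zero hunit

/-- **Theorem 4 (homogeneous case).** Let `p = ℓ₀ℓ₁`, `q = ℓ₂ℓ₃` be linearly
independent products of linear forms in `ℂ[x,y,z]`. If `α₁•p + β₁•q` and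
`α₂•p + β₂•q` are factorizable for two noncollinear vectors `(α₁,β₁)`, `(α₂,β₂)`
with `α₁β₁α₂β₂ ≠ 0`, then all linear combinations `α•p + β•q` are factorizable;
moreover `p` and `q` have a common linear factor, or the four linear forms span
a 2-dimensional space (the four lines are concurrent in the projective plane). -/
theorem two_factorizable_combinations_of_split_quadratics
    (ℓ : Fin 4 → MvPolynomial (Fin 3) ℂ)
    (hℓ : ∀ i, (ℓ i).IsHomogeneous 1)
    (p q : MvPolynomial (Fin 3) ℂ)
    (hp : p = ℓ 0 * ℓ 1) (hq : q = ℓ 2 * ℓ 3)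
    (hind : LinearIndependent ℂ ![p, q])
    (α₁ β₁ α₂ β₂ : ℂ)
    (hnc : α₁ * β₂ - α₂ * β₁ ≠ 0)
    (hne : α₁ * β₁ * α₂ * β₂ ≠ 0)
    (h₁ : Factorizable3 (α₁ • p + β₁ • q))
    (h₂ : Factorizable3 (α₂ • p + β₂ • q)) :
    (∀ α β : ℂ, Factorizable3 (α • p + β • q)) ∧
    ((∃ ℓ' ℓ₁' ℓ₂' : MvPolynomial (Fin 3) ℂ,
        ℓ'.IsHomogeneous 1 ∧ ℓ₁'.IsHomogeneous 1 ∧ ℓ₂'.IsHomogeneous 1 ∧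
        ℓ' ≠ 0 ∧ ℓ₁' ≠ 0 ∧ ℓ₂' ≠ 0 ∧
        p = ℓ' * ℓ₁' ∧ q = ℓ' * ℓ₂') ∨
     Module.finrank ℂ ↥(Submodule.span ℂ (Set.range ℓ)) = 2) := by
  have hp₀ : p ≠ 0 := hind.ne_zero 0
  have hq₀ : q ≠ 0 := hind.ne_zero 1
  choose v hv using fun i => exists_linearCombination_X_eq (hℓ i)
  have split (i j k l : Fin 4) (hr : {ℓ i, ℓ j, ℓ k, ℓ l} = Set.range ℓ)
      (hp : p = ℓ i * ℓ j) (hq : q = ℓ k * ℓ l)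
      (h : Matrix.det (.of ![v k, v i, v j]) = 0) (h' : Matrix.det (.of ![v i, v k, v l]) = 0) := by
    have hdet : Matrix.det (.of ![v j, v i, v k]) = 0 := by
      simp only [Matrix.det_fin_three, Matrix.of_apply, Matrix.cons_val] at h ⊢
      linear_combination -h
    have hdet' : Matrix.det (.of ![v l, v i, v k]) = 0 := by
      simp only [Matrix.det_fin_three, Matrix.of_apply, Matrix.cons_val] at h' ⊢
      linear_combination h'
    have := factorizable3_pencil_of_dependent (hℓ i) (hℓ j) (hℓ k) (hℓ l) (hp ▸ hp₀) (hq ▸ hq₀)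
      (not_linearIndependent_of_det_eq_zero (hv j) (hv i) (hv k) hdet)
      (not_linearIndependent_of_det_eq_zero (hv l) (hv i) (hv k) hdet')
    rwa [← hp, ← hq, hr] at this
  have swap {a b c : Fin 3 → ℂ} (h : Matrix.det (.of ![a, b, c]) = 0) :
      Matrix.det (.of ![a, c, b]) = 0 := by
    simp only [Matrix.det_fin_three, Matrix.of_apply, Matrix.cons_val] at h ⊢
    linear_combination -h
  rw [hp, hq, ← hv 0, ← hv 1, ← hv 2, ← hv 3] at h₁ h₂
  have e₁ := det_relation_of_factorizable3_s2 (left_ne_zero_of_mul (left_ne_zero_of_mul hne)) h₁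
  have e₂ := det_relation_of_factorizable3_s2
    (right_ne_zero_of_mul ((mul_assoc (α₁ * β₁) α₂ β₂) ▸ hne)) h₂
  have hx : Matrix.det (.of ![v 2, v 0, v 1]) * Matrix.det (.of ![v 3, v 0, v 1]) = 0 :=
    (mul_eq_zero.1 (by linear_combination β₂ * e₁ - β₁ * e₂)).resolve_left hnc
  have hy : Matrix.det (.of ![v 0, v 2, v 3]) * Matrix.det (.of ![v 1, v 2, v 3]) = 0 :=
    (mul_eq_zero.1 (by linear_combination α₁ * e₂ - α₂ * e₁)).resolve_left hnc
  have hr : Set.range ℓ = {ℓ 0, ℓ 1, ℓ 2, ℓ 3} := by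
    ext
    simp [Fin.exists_fin_succ, eq_comm]
  rcases mul_eq_zero.1 hx with hx | hx <;> rcases mul_eq_zero.1 hy with hy | hy
  · exact split 0 1 2 3 (by rw [hr]) hp hq hx hy
  · exact split 1 0 2 3 (by rw [hr, Set.insert_comm]) (by rw [hp, mul_comm]) hq (swap hx) hy
  · exact split 0 1 3 2 (by rw [hr, Set.pair_comm]) hp (by rw [hq, mul_comm]) hx (swap hy)
  · exact split 1 0 3 2 (by rw [hr, Set.insert_comm, Set.pair_comm (ℓ 3)])
      (by rw [hp, mul_comm]) (by rw [hq, mul_comm]) (swap hx) (swap hy)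
end

section
/- Let p(x,y,z) = x(x+z) and q(x,y,z) = y(2x+y+z) in ℂ[x,y,z]. Then for (α,β) ∈ ℂ² with (α,β) ≠ (0,0), the polynomial α·p + β·q is factorizable (a product of two homogeneous linear polynomials) if and only if β = 0, or α = 0, or α = β. In particular, there exist exactly three pairwise noncollinear directions (α,β) (namely (1,0), (0,1), (1,1), up to scalar multiples) for which α·p + β·q is factorizable, so three pairwise noncollinear factorizable linear combinations do not force all linear combinations to be factorizable. -/
open MvPolynomial

theorem exists_eq_sum_smul_X_of_isHomogeneous_one {σ R : Type*} [Fintype σ] [CommSemiring R]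
    {p : MvPolynomial σ R} (hp : p.IsHomogeneous 1) :
    ∃ c : σ → R, p = ∑ i, c i • X i := by
  rw [← mem_homogeneousSubmodule, homogeneousSubmodule_one_eq_span_X,
    Submodule.mem_span_range_iff_exists_fun] at hp
  exact hp.imp fun _ => Eq.symm

/-- The discriminant of a product of two ternary linear forms vanishes. -/
theorem discriminant_mul_linear_forms_eq_zero {R : Type*} [CommRing R]
    {a b : Fin 3 → R} {A B C F G H : R}
    (hA : A = a 0 * b 0) (hB : B = a 1 * b 1) (hC : C = a 2 * b 2)
    (hF : F = a 1 * b 2 + a 2 * b 1) (hG : G = a 0 * b 2 + a 2 * b 0)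
    (hH : H = a 0 * b 1 + a 1 * b 0) :
    4 * A * B * C + F * G * H - A * F ^ 2 - B * G ^ 2 - C * H ^ 2 = 0 := by
  subst_vars
  ring

/-- **Counterexample.** For `p = x(x+z)` and `q = y(2x+y+z)` in `ℂ[x,y,z]` and
`(α,β) ≠ (0,0)`, the combination `α•p + β•q` is factorizable iff `β = 0`, `α = 0`,
or `α = β`; so exactly the three pairwise noncollinear directions `(1,0)`, `(0,1)`,
`(1,1)` (up to scalars) give factorizable combinations, and three pairwise
noncollinear factorizable combinations do not force all combinations to be
factorizable. -/
theorem counterexample_exactly_three_factorizable_directions :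
    ∀ α β : ℂ, (α, β) ≠ (0, 0) →
      (Factorizable3
          (α • (X 0 * (X 0 + X 2)) + β • (X 1 * (2 * X 0 + X 1 + X 2)) :
            MvPolynomial (Fin 3) ℂ) ↔
        β = 0 ∨ α = 0 ∨ α = β) := by
  intro α β _
  constructor
  · rintro ⟨l, m, hl, hm, h⟩
    obtain ⟨a, rfl⟩ := exists_eq_sum_smul_X_of_isHomogeneous_one hl
    obtain ⟨b, rfl⟩ := exists_eq_sum_smul_X_of_isHomogeneous_one hm
    have hev (x y z : ℂ) : α * (x * (x + z)) + β * (y * (2 * x + y + z)) =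
        (a 0 * x + a 1 * y + a 2 * z) * (b 0 * x + b 1 * y + b 2 * z) := by
      simpa [Fin.sum_univ_three, smul_eval] using congrArg (eval ![x, y, z]) h
    have hx := hev 1 0 0
    have hy := hev 0 1 0
    have hz := hev 0 0 1
    have hdisc := discriminant_mul_linear_forms_eq_zero (a := a) (b := b)
      (A := α) (B := β) (C := 0) (F := β) (G := α) (H := 2 * β)
      (by linear_combination hx) (by linear_combination hy) (by linear_combination hz)
      (by linear_combination hev 0 1 1 - hy - hz)
      (by linear_combination hev 1 0 1 - hx - hz)
      (by linear_combination hev 1 1 0 - hx - hy)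
    have hprod : β * (α * (α - β)) = 0 := by linear_combination -hdisc
    simpa [sub_eq_zero] using hprod
  · have hX (i : Fin 3) : (X i : MvPolynomial (Fin 3) ℂ).IsHomogeneous 1 := isHomogeneous_X ℂ i
    have hsmul {l : MvPolynomial (Fin 3) ℂ} (hl : l.IsHomogeneous 1) (c : ℂ) :
        (C c * l).IsHomogeneous 1 := hl.C_mul c
    simp only [smul_eq_C_mul]
    rintro (rfl | rfl | rfl)
    · exact ⟨C α * X 0, X 0 + X 2, hsmul (hX 0) α, (hX 0).add (hX 2), by simp; ring⟩
    · refine ⟨C β * X 1, 2 * X 0 + X 1 + X 2, hsmul (hX 1) β, ?_, by simp; ring⟩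
      rw [two_mul]
      exact (((hX 0).add (hX 0)).add (hX 1)).add (hX 2)
    · exact ⟨C α * (X 0 + X 1), X 0 + X 1 + X 2, hsmul ((hX 0).add (hX 1)) α,
        ((hX 0).add (hX 1)).add (hX 2), by ring⟩
end
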